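/- Pointwise generator of the forward–backward diffusion operator is the q-weighted Laplacian (flat Euclidean version): let q be a C^∞ probability density on ℝ^d with q(x) > 0 for all x, all partial derivatives of q bounded, and q(y) ≥ C e^{−c‖y‖²} for some constants C, c > 0. Then for every f ∈ C_c^∞(ℝ^d) and every x ∈ ℝ^d, lim_{ε→0+} ε^{−1} ( D_ε(𝒟_ε f)(x) − f(x) ) = (1/2) q(x)^{−1} ∇·( q ∇f )(x) = (1/2) Δf(x) + (1/(2q(x))) ∇q(x)·∇f(x). -/

import Mathlib

open MeasureTheory Filter
open scoped Topology RealInnerProductSpace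

/-- The Laplacian on `ℝ^d`: sum of the second derivatives in the coordinate directions. -/
noncomputable def laplacian {d : ℕ} (f : EuclideanSpace ℝ (Fin d) → ℝ)
    (x : EuclideanSpace ℝ (Fin d)) : ℝ :=
  ∑ i : Fin d, iteratedFDeriv ℝ 2 f x
    ![EuclideanSpace.single i (1 : ℝ), EuclideanSpace.single i (1 : ℝ)]

/-- The divergence of a vector field on `ℝ^d`. -/
noncomputable def divergence {d : ℕ}
    (V : EuclideanSpace ℝ (Fin d) → EuclideanSpace ℝ (Fin d))
    (x : EuclideanSpace ℝ (Fin d)) : ℝ :=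
  ∑ i : Fin d, fderiv ℝ V x (EuclideanSpace.single i (1 : ℝ)) i

section GaussianWeight

/-- The normalized Gaussian weight `π^{-d/2} exp(-‖z‖²)` on `ℝ^d`. -/
noncomputable def gaussWeight {d : ℕ} (z : EuclideanSpace ℝ (Fin d)) : ℝ :=
  Real.pi ^ (-(d : ℝ) / 2) * Real.exp (-‖z‖ ^ 2)

/-- The average of `G (y + s z)` over `z` with respect to the Gaussian weight. -/
noncomputable def gaussMean {d : ℕ} (s : ℝ) (G : EuclideanSpace ℝ (Fin d) → ℝ)
    (y : EuclideanSpace ℝ (Fin d)) : ℝ :=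
  ∫ z, gaussWeight z * G (y + s • z)

variable {d : ℕ}

lemma gaussWeight_pos (z : EuclideanSpace ℝ (Fin d)) : 0 < gaussWeight z := by
  unfold gaussWeight; positivity

lemma continuous_gaussWeight :
    Continuous (gaussWeight : EuclideanSpace ℝ (Fin d) → ℝ) := by
  unfold gaussWeight; fun_prop

lemma integral_gaussWeight : ∫ z : EuclideanSpace ℝ (Fin d), gaussWeight z = 1 := by
  have h := GaussianFourier.integral_rexp_neg_mul_sq_norm
    (V := EuclideanSpace ℝ (Fin d)) one_pos
  simp only [neg_mul, one_mul, div_one, finrank_euclideanSpace, Fintype.card_fin] at h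
  simp only [gaussWeight, integral_const_mul, h]
  rw [← Real.rpow_add Real.pi_pos, neg_div, neg_add_cancel, Real.rpow_zero]

lemma integrable_one_add_norm_pow_four_mul_gaussWeight :
    Integrable (fun z : EuclideanSpace ℝ (Fin d) => (1 + ‖z‖ ^ 4) * gaussWeight z) := by
  have hint : Integrable (fun z : EuclideanSpace ℝ (Fin d) => Real.exp (-(1 / 2) * ‖z‖ ^ 2)) := by
    refine not_imp_comm.1 integral_undef ?_
    rw [GaussianFourier.integral_rexp_neg_mul_sq_norm (by norm_num)]
    positivity
  refine (hint.const_mul (9 * Real.pi ^ (-(d : ℝ) / 2))).mono'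
    (by have := continuous_gaussWeight (d := d); fun_prop) (.of_forall fun z => ?_)
  rw [Real.norm_of_nonneg (mul_nonneg (by positivity) (gaussWeight_pos z).le)]
  have h2 := Real.pow_div_factorial_le_exp (‖z‖ ^ 2 / 2) (by positivity) 2
  have h1 := Real.one_le_exp (show 0 ≤ ‖z‖ ^ 2 / 2 by positivity)
  have h3 : 1 + ‖z‖ ^ 4 ≤ 9 * Real.exp (‖z‖ ^ 2 / 2) := by
    norm_num [Nat.factorial] at h2
    nlinarith
  have h4 : Real.exp (-(1 / 2) * ‖z‖ ^ 2) =
      Real.exp (‖z‖ ^ 2 / 2) * Real.exp (-‖z‖ ^ 2) := by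
    rw [← Real.exp_add]; congr 1; ring
  rw [gaussWeight, h4]
  calc _ ≤ 9 * Real.exp (‖z‖ ^ 2 / 2) *
        (Real.pi ^ (-(d : ℝ) / 2) * Real.exp (-‖z‖ ^ 2)) := by gcongr
    _ = _ := by ring

lemma integrable_gaussWeight_mul {g : EuclideanSpace ℝ (Fin d) → ℝ}
    (hg : AEStronglyMeasurable g) {K : ℝ} (hK : ∀ z, ‖g z‖ ≤ K * (1 + ‖z‖ ^ 4)) :
    Integrable (fun z => gaussWeight z * g z) := by
  refine (integrable_one_add_norm_pow_four_mul_gaussWeight.const_mul K).mono'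
    (continuous_gaussWeight.aestronglyMeasurable.mul hg) (.of_forall fun z => ?_)
  rw [norm_mul, Real.norm_of_nonneg (gaussWeight_pos z).le]
  calc gaussWeight z * ‖g z‖ ≤ gaussWeight z * (K * (1 + ‖z‖ ^ 4)) :=
        mul_le_mul_of_nonneg_left (hK z) (gaussWeight_pos z).le
    _ = _ := by ring

lemma integrable_gaussWeight_mul_norm_pow {k : ℕ} (hk : k ≤ 4) :
    Integrable (fun z : EuclideanSpace ℝ (Fin d) => gaussWeight z * ‖z‖ ^ k) := by
  refine integrable_gaussWeight_mul (by fun_prop) (K := 1) fun z => ?_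
  rw [norm_pow, norm_norm, one_mul]
  rcases le_total ‖z‖ 1 with h | h
  · have := pow_le_one₀ (norm_nonneg z) h (n := k)
    have : 0 ≤ ‖z‖ ^ 4 := by positivity
    linarith
  · have := pow_le_pow_right₀ h hk
    linarith

lemma integrable_gaussWeight_mul_of_bounded {g : EuclideanSpace ℝ (Fin d) → ℝ}
    (hg : AEStronglyMeasurable g) {M : ℝ} (hM : ∀ z, ‖g z‖ ≤ M) :
    Integrable (fun z => gaussWeight z * g z) := by
  refine integrable_gaussWeight_mul hg (K := M) fun z => (hM z).trans ?_
  have : 0 ≤ M := (norm_nonneg _).trans (hM z)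
  exact le_mul_of_one_le_right this (by linarith [show 0 ≤ ‖z‖ ^ 4 by positivity])

lemma integral_gaussWeight_mul_linear (A : EuclideanSpace ℝ (Fin d) →L[ℝ] ℝ) :
    ∫ z, gaussWeight z * A z = 0 := by
  have h := integral_neg_eq_self (fun z => gaussWeight z * A z) volume
  simp only [gaussWeight, norm_neg, map_neg, mul_neg, integral_neg] at h ⊢
  linarith

lemma integrable_gaussWeight_mul_linear (A : EuclideanSpace ℝ (Fin d) →L[ℝ] ℝ) :
    Integrable (fun z => gaussWeight z * A z) := by
  refine ((integrable_gaussWeight_mul_norm_pow (d := d) (k := 1) (by norm_num)).const_mul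
    ‖A‖).mono' (by have := continuous_gaussWeight (d := d); fun_prop) (.of_forall fun z => ?_)
  rw [norm_mul, Real.norm_of_nonneg (gaussWeight_pos z).le, pow_one, mul_left_comm]
  exact mul_le_mul_of_nonneg_left (A.le_opNorm z) (gaussWeight_pos z).le

lemma integrable_gaussWeight_mul_linear_mul_linear (A B : EuclideanSpace ℝ (Fin d) →L[ℝ] ℝ) :
    Integrable (fun z => gaussWeight z * (A z * B z)) := by
  refine ((integrable_gaussWeight_mul_norm_pow (d := d) (k := 2) (by norm_num)).const_mul
    (‖A‖ * ‖B‖)).mono' (by have := continuous_gaussWeight (d := d); fun_prop)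
    (.of_forall fun z => ?_)
  rw [norm_mul, Real.norm_of_nonneg (gaussWeight_pos z).le, mul_left_comm]
  refine mul_le_mul_of_nonneg_left ?_ (gaussWeight_pos z).le
  rw [norm_mul]
  calc ‖A z‖ * ‖B z‖ ≤ (‖A‖ * ‖z‖) * (‖B‖ * ‖z‖) := by
        gcongr
        · exact A.le_opNorm z
        · exact B.le_opNorm z
    _ = _ := by ring

lemma hasFDerivAt_gaussWeight (z : EuclideanSpace ℝ (Fin d)) :
    HasFDerivAt gaussWeight ((-2 * gaussWeight z) • innerSL ℝ z) z := by
  have h := (((hasStrictFDerivAt_norm_sq z).hasFDerivAt.neg).exp).const_mul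
    (Real.pi ^ (-(d : ℝ) / 2))
  refine h.congr_fderiv ?_
  ext v
  simp [gaussWeight]
  ring

/-- Gaussian integration by parts for a linear integrand. -/
lemma integral_gaussWeight_mul_inner_mul_linear (v : EuclideanSpace ℝ (Fin d))
    (A : EuclideanSpace ℝ (Fin d) →L[ℝ] ℝ) :
    ∫ z, gaussWeight z * (⟪v, z⟫ * A z) = A v / 2 := by
  have hAv : ∀ z, A z * ((-2 * gaussWeight z) • innerSL ℝ z) v
      = -2 * (gaussWeight z * (innerSL ℝ v z * A z)) := fun z => by
    simp [real_inner_comm v z]; ring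
  have h := integral_bilinear_hasFDerivAt_right_eq_neg_left_of_integrable (μ := volume)
    (f := fun z => A z) (f' := fun _ => A) (g := gaussWeight)
    (g' := fun z => (-2 * gaussWeight z) • innerSL ℝ z) (v := v)
    (B := ContinuousLinearMap.mul ℝ ℝ)
    (by
      have := (integrable_gaussWeight_mul_norm_pow (d := d) (k := 0) (by norm_num)).const_mul (A v)
      simpa using this)
    (by
      simp only [ContinuousLinearMap.mul_apply', hAv]
      exact (integrable_gaussWeight_mul_linear_mul_linear (innerSL ℝ v) A).const_mul (-2))
    (by
      simp only [ContinuousLinearMap.mul_apply', mul_comm (A _)]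
      exact integrable_gaussWeight_mul_linear A)
    (fun z _ => A.hasFDerivAt) (fun z _ => hasFDerivAt_gaussWeight z)
  simp only [ContinuousLinearMap.mul_apply', hAv, integral_const_mul, integral_gaussWeight,
    innerSL_apply_apply] at h
  linarith

lemma bilinear_self_eq_sum
    (B : EuclideanSpace ℝ (Fin d) →L[ℝ] EuclideanSpace ℝ (Fin d) →L[ℝ] ℝ)
    (z : EuclideanSpace ℝ (Fin d)) :
    B z z = ∑ i, ⟪EuclideanSpace.single i (1 : ℝ), z⟫ * B (EuclideanSpace.single i (1 : ℝ)) z := by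
  have hz := congrArg (fun w => B w z) ((EuclideanSpace.basisFun (Fin d) ℝ).sum_repr' z)
  simpa using hz.symm

lemma integrable_gaussWeight_mul_bilinear
    (B : EuclideanSpace ℝ (Fin d) →L[ℝ] EuclideanSpace ℝ (Fin d) →L[ℝ] ℝ) :
    Integrable (fun z => gaussWeight z * B z z) := by
  simp only [bilinear_self_eq_sum B, Finset.mul_sum]
  exact integrable_finsetSum _ fun i _ => integrable_gaussWeight_mul_linear_mul_linear
    (innerSL ℝ (EuclideanSpace.single i (1 : ℝ))) (B (EuclideanSpace.single i (1 : ℝ)))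

lemma integral_gaussWeight_mul_bilinear
    (B : EuclideanSpace ℝ (Fin d) →L[ℝ] EuclideanSpace ℝ (Fin d) →L[ℝ] ℝ) :
    ∫ z, gaussWeight z * B z z =
      (∑ i, B (EuclideanSpace.single i (1 : ℝ)) (EuclideanSpace.single i (1 : ℝ))) / 2 := by
  have h : ∀ z, gaussWeight z * B z z = ∑ i, gaussWeight z *
      (⟪EuclideanSpace.single i (1 : ℝ), z⟫ * B (EuclideanSpace.single i (1 : ℝ)) z) := fun z => by
    rw [bilinear_self_eq_sum B, Finset.mul_sum]
  simp only [h]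
  rw [integral_finsetSum, Finset.sum_div]
  · simp only [integral_gaussWeight_mul_inner_mul_linear]
  · exact fun i _ => integrable_gaussWeight_mul_linear_mul_linear
      (innerSL ℝ (EuclideanSpace.single i (1 : ℝ))) (B (EuclideanSpace.single i (1 : ℝ)))

end GaussianWeight

section Taylor

variable {E : Type*} [NormedAddCommGroup E] [NormedSpace ℝ E]

lemma abs_sub_taylor_two_le {G : E → ℝ} (hG : ContDiff ℝ 2 G) {K : NNReal}
    (hK : LipschitzWith K (fderiv ℝ (fderiv ℝ G))) (y v : E) :
    |G (y + v) - G y - fderiv ℝ G y v - 1 / 2 * fderiv ℝ (fderiv ℝ G) y v v| ≤ K * ‖v‖ ^ 3 := by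
  have hG1 : Differentiable ℝ G := hG.differentiable (by norm_num)
  have hG2 : Differentiable ℝ (fderiv ℝ G) :=
    (hG.fderiv_right (m := 1) (by norm_num)).differentiable (by norm_num)
  -- first-order expansion of the derivative
  have hS : ∀ u : E, ‖fderiv ℝ G (y + u) - fderiv ℝ G y - fderiv ℝ (fderiv ℝ G) y u‖
      ≤ K * ‖u‖ * ‖u‖ := by
    intro u
    have hd : ∀ w ∈ segment ℝ y (y + u), HasFDerivWithinAt (fderiv ℝ G)
        (fderiv ℝ (fderiv ℝ G) w) (segment ℝ y (y + u)) w :=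
      fun w _ => (hG2 w).hasFDerivAt.hasFDerivWithinAt
    have hb : ∀ w ∈ segment ℝ y (y + u),
        ‖fderiv ℝ (fderiv ℝ G) w - fderiv ℝ (fderiv ℝ G) y‖ ≤ K * ‖u‖ := by
      intro w hw
      refine (hK.norm_sub_le w y).trans ?_
      gcongr
      simpa using norm_sub_le_of_mem_segment hw
    have := (convex_segment y (y + u)).norm_image_sub_le_of_norm_hasFDerivWithin_le' hd hb
      (left_mem_segment ℝ y (y + u)) (right_mem_segment ℝ y (y + u))
    simpa using this
  let R : ℝ → ℝ := fun t =>
    G (y + t • v) - t * fderiv ℝ G y v - t ^ 2 / 2 * fderiv ℝ (fderiv ℝ G) y v v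
  have hR : ∀ t ∈ Set.Icc (0 : ℝ) 1, HasDerivWithinAt R
      ((fderiv ℝ G (y + t • v) - fderiv ℝ G y - fderiv ℝ (fderiv ℝ G) y (t • v)) v)
      (Set.Icc 0 1) t := by
    intro t _
    have hl : HasDerivAt (fun t : ℝ => y + t • v) v t := by
      simpa using ((hasDerivAt_id t).smul_const v).const_add y
    have h1 := (hG1 (y + t • v)).hasFDerivAt.comp_hasDerivAt t hl
    have h2 := (hasDerivAt_id t).mul_const (fderiv ℝ G y v)
    have h3 := (((hasDerivAt_id t).pow 2).div_const 2).mul_const (fderiv ℝ (fderiv ℝ G) y v v)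
    refine (((h1.sub h2).sub h3).congr_deriv ?_).hasDerivWithinAt
    simp
  have := norm_image_sub_le_of_norm_deriv_le_segment_01' (C := K * ‖v‖ ^ 3) hR fun t ht => by
    refine (ContinuousLinearMap.le_opNorm _ _).trans ?_
    have htv : ‖t • v‖ ≤ ‖v‖ := by
      rw [norm_smul, Real.norm_of_nonneg ht.1]
      exact mul_le_of_le_one_left (norm_nonneg _) ht.2.le
    calc _ ≤ (K * ‖t • v‖ * ‖t • v‖) * ‖v‖ := by gcongr; exact hS _
      _ ≤ (K * ‖v‖ * ‖v‖) * ‖v‖ := by gcongr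
      _ = _ := by ring
  refine le_of_eq_of_le ?_ this
  rw [Real.norm_eq_abs]
  congr 1
  simp [R]
  ring

lemma exists_lipschitzWith_fderiv_fderiv {G : E → ℝ} (hG : ContDiff ℝ 3 G) {C : ℝ}
    (hC : ∀ x, ‖iteratedFDeriv ℝ 3 G x‖ ≤ C) :
    ∃ K : NNReal, LipschitzWith K (fderiv ℝ (fderiv ℝ G)) := by
  refine ⟨C.toNNReal, lipschitzWith_of_nnnorm_fderiv_le (𝕜 := ℝ) ?_ fun x => ?_⟩
  · exact ((hG.fderiv_right (m := 2) (by norm_num)).fderiv_right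
      (m := 1) (by norm_num)).differentiable (by norm_num)
  · rw [← NNReal.coe_le_coe, coe_nnnorm, ← norm_iteratedFDeriv_one,
      norm_iteratedFDeriv_fderiv, norm_iteratedFDeriv_fderiv]
    exact (hC x).trans (Real.le_coe_toNNReal C)

lemma exists_norm_iteratedFDeriv_le_of_hasCompactSupport {G : E → ℝ} (hs : HasCompactSupport G)
    {n : ℕ} (hG : ContDiff ℝ n G) : ∃ C, ∀ x, ‖iteratedFDeriv ℝ n G x‖ ≤ C :=
  (hs.iteratedFDeriv n).exists_bound_of_continuous (hG.continuous_iteratedFDeriv le_rfl)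

end Taylor

section HeatExpansion

variable {d : ℕ}

lemma laplacian_eq_sum_fderiv (G : EuclideanSpace ℝ (Fin d) → ℝ) (y : EuclideanSpace ℝ (Fin d)) :
    laplacian G y = ∑ i, fderiv ℝ (fderiv ℝ G) y (EuclideanSpace.single i (1 : ℝ))
      (EuclideanSpace.single i (1 : ℝ)) := by
  simp [laplacian, iteratedFDeriv_two_apply]

lemma continuous_laplacian {G : EuclideanSpace ℝ (Fin d) → ℝ} (hG : ContDiff ℝ 2 G) :
    Continuous (laplacian G) := by
  have : Continuous (fderiv ℝ (fderiv ℝ G)) :=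
    (hG.fderiv_right (m := 1) (by norm_num)).continuous_fderiv (by norm_num)
  simp only [funext (laplacian_eq_sum_fderiv G)]
  fun_prop

lemma exists_abs_laplacian_le {G : EuclideanSpace ℝ (Fin d) → ℝ} {C : ℝ}
    (hC : ∀ x, ‖iteratedFDeriv ℝ 2 G x‖ ≤ C) : ∃ L, ∀ y, |laplacian G y| ≤ L := by
  refine ⟨∑ _i : Fin d, C, fun y => ?_⟩
  rw [laplacian]
  refine (Finset.abs_sum_le_sum_abs _ Finset.univ).trans (Finset.sum_le_sum fun i _ => ?_)
  refine ((iteratedFDeriv ℝ 2 G y).le_opNorm _).trans ?_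
  simpa [Fin.prod_univ_two] using hC y

lemma gaussMean_integrable {G : EuclideanSpace ℝ (Fin d) → ℝ} (hG : Measurable G) {M : ℝ}
    (hM : ∀ y, |G y| ≤ M) (s : ℝ) (y : EuclideanSpace ℝ (Fin d)) :
    Integrable (fun z => gaussWeight z * G (y + s • z)) :=
  integrable_gaussWeight_mul_of_bounded
    (hG.comp (by fun_prop : Measurable fun z => y + s • z)).aestronglyMeasurable fun z => hM _

lemma continuous_gaussMean {G : EuclideanSpace ℝ (Fin d) → ℝ} (hG : Continuous G) {M : ℝ}
    (hM : ∀ y, |G y| ≤ M) (s : ℝ) : Continuous (gaussMean s G) := by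
  have hint : Integrable (fun z : EuclideanSpace ℝ (Fin d) => gaussWeight z * M) :=
    integrable_gaussWeight_mul_of_bounded aestronglyMeasurable_const (M := |M|) fun _ => le_rfl
  refine continuous_of_dominated (bound := fun z => gaussWeight z * M)
    (fun y => (gaussMean_integrable hG.measurable hM s y).aestronglyMeasurable)
    (fun y => .of_forall fun z => ?_) hint (.of_forall fun z => by fun_prop)
  rw [norm_mul, Real.norm_of_nonneg (gaussWeight_pos z).le]
  exact mul_le_mul_of_nonneg_left (hM _) (gaussWeight_pos z).le

/-- Second-order expansion of Gaussian averages, uniform in the base point. -/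
lemma exists_abs_gaussMean_sub_le {G : EuclideanSpace ℝ (Fin d) → ℝ} (hG : ContDiff ℝ 3 G)
    {M C : ℝ} (hM : ∀ y, |G y| ≤ M) (hC : ∀ y, ‖iteratedFDeriv ℝ 3 G y‖ ≤ C) :
    ∃ K, 0 ≤ K ∧ ∀ s, 0 ≤ s → ∀ y,
      |gaussMean s G y - G y - s ^ 2 / 4 * laplacian G y| ≤ K * s ^ 3 := by
  obtain ⟨K, hK⟩ := exists_lipschitzWith_fderiv_fderiv hG hC
  refine ⟨K * ∫ z : EuclideanSpace ℝ (Fin d), gaussWeight z * ‖z‖ ^ 3, by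
    have : 0 ≤ ∫ z : EuclideanSpace ℝ (Fin d), gaussWeight z * ‖z‖ ^ 3 :=
      integral_nonneg fun z => mul_nonneg (gaussWeight_pos z).le (by positivity)
    positivity, fun s hs y => ?_⟩
  set A := fderiv ℝ G y
  set B := fderiv ℝ (fderiv ℝ G) y
  have i0 := gaussMean_integrable hG.continuous.measurable hM s y
  have i1 : Integrable (fun z : EuclideanSpace ℝ (Fin d) => gaussWeight z * G y) :=
    integrable_gaussWeight_mul_of_bounded aestronglyMeasurable_const (M := |G y|) fun _ => le_rfl
  have i2 := (integrable_gaussWeight_mul_linear A).const_mul s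
  have i3 := (integrable_gaussWeight_mul_bilinear B).const_mul (s ^ 2 / 2)
  have i01 : Integrable (fun z => gaussWeight z * G (y + s • z) - gaussWeight z * G y) :=
    i0.sub i1
  have i012 : Integrable (fun z => gaussWeight z * G (y + s • z) - gaussWeight z * G y
      - s * (gaussWeight z * A z)) := i01.sub i2
  have key : gaussMean s G y - G y - s ^ 2 / 4 * laplacian G y =
      ∫ z, gaussWeight z * (G (y + s • z) - G y - A (s • z) - 1 / 2 * B (s • z) (s • z)) := by
    have : ∀ z, gaussWeight z * (G (y + s • z) - G y - A (s • z) - 1 / 2 * B (s • z) (s • z)) =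
        gaussWeight z * G (y + s • z) - gaussWeight z * G y - s * (gaussWeight z * A z)
          - s ^ 2 / 2 * (gaussWeight z * B z z) := fun z => by
      simp only [map_smul, _root_.smul_apply, smul_eq_mul]; ring
    simp only [this]
    rw [integral_sub i012 i3, integral_sub i01 i2, integral_sub i0 i1,
      integral_const_mul, integral_const_mul, integral_mul_const, integral_gaussWeight,
      integral_gaussWeight_mul_linear, integral_gaussWeight_mul_bilinear,
      laplacian_eq_sum_fderiv, gaussMean]
    ring
  rw [key, ← Real.norm_eq_abs]
  refine (norm_integral_le_of_norm_le (((integrable_gaussWeight_mul_norm_pow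
    (d := d) (k := 3) (by norm_num)).const_mul (K * s ^ 3))) (.of_forall fun z => ?_)).trans_eq ?_
  · rw [norm_mul, Real.norm_of_nonneg (gaussWeight_pos z).le, mul_left_comm]
    refine mul_le_mul_of_nonneg_left ?_ (gaussWeight_pos z).le
    refine (abs_sub_taylor_two_le (hG.of_le (by norm_num)) hK y (s • z)).trans_eq ?_
    rw [norm_smul, Real.norm_of_nonneg hs]
    ring
  · rw [integral_const_mul]; ring

end HeatExpansion

section VectorCalculus

variable {d : ℕ}

lemma gradient_apply_eq_fderiv (f : EuclideanSpace ℝ (Fin d) → ℝ) (x : EuclideanSpace ℝ (Fin d))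
    (i : Fin d) : gradient f x i = fderiv ℝ f x (EuclideanSpace.single i (1 : ℝ)) := by
  rw [← inner_gradient_left, EuclideanSpace.inner_single_right]
  simp

lemma inner_gradient_eq_sum (q f : EuclideanSpace ℝ (Fin d) → ℝ) (x : EuclideanSpace ℝ (Fin d)) :
    ⟪gradient q x, gradient f x⟫ = ∑ i, fderiv ℝ q x (EuclideanSpace.single i (1 : ℝ)) *
      fderiv ℝ f x (EuclideanSpace.single i (1 : ℝ)) := by
  simp only [PiLp.inner_apply, gradient_apply_eq_fderiv]
  exact Finset.sum_congr rfl fun i _ => mul_comm _ _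

lemma divergence_smul_gradient {q f : EuclideanSpace ℝ (Fin d) → ℝ} (hq : ContDiff ℝ 1 q)
    (hf : ContDiff ℝ 2 f) (x : EuclideanSpace ℝ (Fin d)) :
    divergence (fun y => q y • gradient f y) x =
      q x * laplacian f x + ⟪gradient q x, gradient f x⟫ := by
  have hq1 : Differentiable ℝ q := hq.differentiable (by norm_num)
  have hf2 : Differentiable ℝ (fderiv ℝ f) :=
    (hf.fderiv_right (m := 1) (by norm_num)).differentiable (by norm_num)
  have hcomp : ∀ i, HasFDerivAt (fun y => (q y • gradient f y) i) _ x := fun i => by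
    simp only [PiLp.smul_apply, smul_eq_mul, gradient_apply_eq_fderiv]
    exact (hq1 x).hasFDerivAt.mul
      ((hf2 x).hasFDerivAt.clm_apply (hasFDerivAt_const (EuclideanSpace.single i (1 : ℝ)) x))
  have hV : HasFDerivAt (fun y => q y • gradient f y)
      (fderiv ℝ (fun y => q y • gradient f y) x) x :=
    (differentiableAt_euclidean.2 fun i => (hcomp i).differentiableAt).hasFDerivAt
  rw [inner_gradient_eq_sum]
  simp only [divergence, laplacian_eq_sum_fderiv, Finset.mul_sum, ← Finset.sum_add_distrib]
  refine Finset.sum_congr rfl fun i _ => ?_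
  have hunique := ((EuclideanSpace.proj (𝕜 := ℝ) i).hasFDerivAt.comp x hV).unique (hcomp i)
  have h := congrArg (fun A => A (EuclideanSpace.single i (1 : ℝ))) hunique
  simpa [mul_comm] using h

end VectorCalculus

section Generator

variable {d : ℕ}

lemma rpow_mul_integral_eq_gaussMean {s : ℝ} (hs : 0 < s) (g : EuclideanSpace ℝ (Fin d) → ℝ)
    (x : EuclideanSpace ℝ (Fin d)) :
    (s ^ 2) ^ (-(d : ℝ) / 2) *
      ∫ y, Real.pi ^ (-(d : ℝ) / 2) * Real.exp (-‖x - y‖ ^ 2 / s ^ 2) * g y = gaussMean s g x := by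
  have h1 := integral_add_left_eq_self (μ := volume)
    (fun y => Real.pi ^ (-(d : ℝ) / 2) * Real.exp (-‖x - y‖ ^ 2 / s ^ 2) * g y) x
  have h2 := Measure.integral_comp_smul_of_nonneg (volume : Measure (EuclideanSpace ℝ (Fin d)))
    (fun v => Real.pi ^ (-(d : ℝ) / 2) * Real.exp (-‖x - (x + v)‖ ^ 2 / s ^ 2) * g (x + v)) s
    (hR := hs.le)
  rw [h1, finrank_euclideanSpace, Fintype.card_fin, smul_eq_mul] at h2
  have h3 : (s ^ 2) ^ (-(d : ℝ) / 2) = (s ^ d)⁻¹ := by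
    rw [← Real.rpow_natCast s 2, ← Real.rpow_mul hs.le, ← Real.rpow_natCast s d,
      ← Real.rpow_neg hs.le]
    congr 1
    push_cast
    ring
  rw [h3, ← h2, gaussMean]
  refine integral_congr_ae (.of_forall fun z => ?_)
  have h4 : -‖x - (x + s • z)‖ ^ 2 / s ^ 2 = -‖z‖ ^ 2 := by
    rw [sub_add_cancel_left, norm_neg, norm_smul, Real.norm_of_nonneg hs.le]
    field_simp
  simp only [gaussWeight, h4]

lemma tendsto_gaussMean_diffQuotient {G : EuclideanSpace ℝ (Fin d) → ℝ} (hG : ContDiff ℝ 2 G)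
    {K : ℝ} (hK : ∀ s, 0 ≤ s → ∀ y,
      |gaussMean s G y - G y - s ^ 2 / 4 * laplacian G y| ≤ K * s ^ 3)
    (x z : EuclideanSpace ℝ (Fin d)) :
    Tendsto (fun s : ℝ => (s ^ 2)⁻¹ * (gaussMean s G (x + s • z) - G (x + s • z)))
      (𝓝[>] 0) (𝓝 (laplacian G x / 4)) := by
  have hlap : Tendsto (fun s : ℝ => laplacian G (x + s • z) / 4) (𝓝[>] 0)
      (𝓝 (laplacian G x / 4)) := by
    have hc : Continuous fun s : ℝ => laplacian G (x + s • z) / 4 := by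
      have := continuous_laplacian hG
      fun_prop
    simpa using (hc.tendsto 0).mono_left nhdsWithin_le_nhds
  have hlin : Tendsto (fun s : ℝ => K * s) (𝓝[>] 0) (𝓝 0) := by
    have hc : Continuous fun s : ℝ => K * s := by fun_prop
    simpa using (hc.tendsto 0).mono_left nhdsWithin_le_nhds
  have hdiff : Tendsto (fun s : ℝ => (s ^ 2)⁻¹ * (gaussMean s G (x + s • z) - G (x + s • z))
      - laplacian G (x + s • z) / 4) (𝓝[>] 0) (𝓝 0) := by
    refine squeeze_zero_norm' ?_ hlin
    filter_upwards [self_mem_nhdsWithin] with s (hs : 0 < s)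
    have : (s ^ 2)⁻¹ * (gaussMean s G (x + s • z) - G (x + s • z)) - laplacian G (x + s • z) / 4
        = (s ^ 2)⁻¹ * (gaussMean s G (x + s • z) - G (x + s • z)
          - s ^ 2 / 4 * laplacian G (x + s • z)) := by
      field_simp
    rw [this, norm_mul, Real.norm_of_nonneg (by positivity), Real.norm_eq_abs]
    calc _ ≤ (s ^ 2)⁻¹ * (K * s ^ 3) := by gcongr; exact hK s hs.le _
      _ = K * s := by field_simp
  simpa using hdiff.add hlap

lemma abs_gaussMean_sub_le {G : EuclideanSpace ℝ (Fin d) → ℝ} {K L : ℝ} (hK0 : 0 ≤ K)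
    (hK : ∀ s, 0 ≤ s → ∀ y, |gaussMean s G y - G y - s ^ 2 / 4 * laplacian G y| ≤ K * s ^ 3)
    (hL : ∀ y, |laplacian G y| ≤ L) {s : ℝ} (hs : 0 ≤ s) (hs1 : s ≤ 1)
    (y : EuclideanSpace ℝ (Fin d)) : |gaussMean s G y - G y| ≤ s ^ 2 * (K + L) := by
  have h1 := abs_le.1 (hK s hs y)
  have h2 := abs_le.1 (hL y)
  have h3 : K * s ^ 3 ≤ s ^ 2 * K := by nlinarith [mul_nonneg hK0 (sq_nonneg s)]
  have h4 : |s ^ 2 / 4 * laplacian G y| ≤ s ^ 2 * L := by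
    rw [abs_mul, abs_of_nonneg (by positivity)]
    have := hL y
    have := (abs_nonneg _).trans this
    calc _ ≤ s ^ 2 / 4 * L := by gcongr
      _ ≤ _ := by nlinarith [mul_nonneg (sq_nonneg s) this]
  have h5 := abs_le.1 h4
  rw [abs_le]
  constructor <;> nlinarith

lemma gaussMean_nonneg {G : EuclideanSpace ℝ (Fin d) → ℝ} (hG : ∀ y, 0 ≤ G y) (s : ℝ)
    (y : EuclideanSpace ℝ (Fin d)) : 0 ≤ gaussMean s G y :=
  integral_nonneg fun z => mul_nonneg (gaussWeight_pos z).le (hG _)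

lemma abs_gaussMean_mul_div_le {q f : EuclideanSpace ℝ (Fin d) → ℝ} (hq : Continuous q)
    (hq0 : ∀ y, 0 ≤ q y) {Mq Mf : ℝ} (hMq : ∀ y, |q y| ≤ Mq) (hMf : ∀ y, |f y| ≤ Mf)
    (s : ℝ) (y : EuclideanSpace ℝ (Fin d)) :
    |gaussMean s (fun y => q y * f y) y / gaussMean s q y| ≤ Mf := by
  have hMf0 : 0 ≤ Mf := (abs_nonneg _).trans (hMf 0)
  rw [abs_div, abs_of_nonneg (gaussMean_nonneg hq0 s y)]
  refine div_le_of_le_mul₀ (gaussMean_nonneg hq0 s y) hMf0 ?_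
  rw [gaussMean, gaussMean, ← integral_const_mul, ← Real.norm_eq_abs]
  refine norm_integral_le_of_norm_le
    ((gaussMean_integrable hq.measurable hMq s y).const_mul Mf) (.of_forall fun z => ?_)
  have h := mul_nonneg (gaussWeight_pos z).le (hq0 (y + s • z))
  rw [← mul_assoc, norm_mul, Real.norm_of_nonneg h, mul_comm Mf]
  exact mul_le_mul_of_nonneg_left (hMf _) h

lemma gaussMean_diffQuotient_div_eq {q f : EuclideanSpace ℝ (Fin d) → ℝ} {s : ℝ}
    {y : EuclideanSpace ℝ (Fin d)} (h : gaussMean s q y ≠ 0) :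
    (s ^ 2)⁻¹ * (gaussMean s (fun y => q y * f y) y / gaussMean s q y - f y) =
      ((s ^ 2)⁻¹ * (gaussMean s (fun y => q y * f y) y - q y * f y)
        - f y * ((s ^ 2)⁻¹ * (gaussMean s q y - q y))) / gaussMean s q y := by
  rw [div_sub' h, eq_div_iff h, mul_assoc, div_mul_cancel₀ _ h]
  ring

lemma tendsto_gaussMean_normalized_diffQuotient {q f : EuclideanSpace ℝ (Fin d) → ℝ}
    (hq : ContDiff ℝ 3 q) (hq0 : ∀ y, 0 < q y)
    (hqb : ∀ n : ℕ, ∃ C, ∀ y, ‖iteratedFDeriv ℝ n q y‖ ≤ C)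
    (hf : ContDiff ℝ 3 f) (hfs : HasCompactSupport f) (x : EuclideanSpace ℝ (Fin d)) :
    Tendsto (fun s : ℝ => (s ^ 2)⁻¹ *
        (gaussMean s (fun y => gaussMean s (fun y => q y * f y) y / gaussMean s q y) x - f x))
      (𝓝[>] 0)
      (𝓝 ((laplacian (fun y => q y * f y) x / 4 - f x * (laplacian q x / 4)) / q x
        + laplacian f x / 4)) := by
  set F : EuclideanSpace ℝ (Fin d) → ℝ := fun y => q y * f y
  have hF : ContDiff ℝ 3 F := hq.mul hf
  have hFs : HasCompactSupport F := hfs.mul_left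
  obtain ⟨Mq, hMq⟩ : ∃ M, ∀ y, |q y| ≤ M := by simpa using hqb 0
  obtain ⟨Mf, hMf⟩ : ∃ M, ∀ y, |f y| ≤ M := hfs.exists_bound_of_continuous hf.continuous
  obtain ⟨MF, hMF⟩ : ∃ M, ∀ y, |F y| ≤ M := hFs.exists_bound_of_continuous hF.continuous
  obtain ⟨Kq, hKq0, hKq⟩ := exists_abs_gaussMean_sub_le hq hMq (hqb 3).choose_spec
  obtain ⟨Kf, -, hKf⟩ := exists_abs_gaussMean_sub_le hf hMf
    (exists_norm_iteratedFDeriv_le_of_hasCompactSupport hfs (n := 3) hf).choose_spec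
  obtain ⟨KF, hKF0, hKF⟩ := exists_abs_gaussMean_sub_le hF hMF
    (exists_norm_iteratedFDeriv_le_of_hasCompactSupport hFs (n := 3) hF).choose_spec
  obtain ⟨Lq, hLq⟩ := exists_abs_laplacian_le (hqb 2).choose_spec
  obtain ⟨LF, hLF⟩ := exists_abs_laplacian_le
    (exists_norm_iteratedFDeriv_le_of_hasCompactSupport hFs (n := 2)
      (hF.of_le (by norm_num))).choose_spec
  have hMf0 : 0 ≤ Mf := (abs_nonneg _).trans (hMf 0)
  have hLq0 : 0 ≤ Lq := (abs_nonneg _).trans (hLq 0)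
  have hLF0 : 0 ≤ LF := (abs_nonneg _).trans (hLF 0)
  obtain ⟨m, hm0, hm⟩ : ∃ m, 0 < m ∧ ∀ y ∈ Metric.closedBall x 1, m ≤ q y := by
    obtain ⟨y, -, hy⟩ := (isCompact_closedBall x 1).exists_isMinOn
      ⟨x, Metric.mem_closedBall_self zero_le_one⟩ hq.continuous.continuousOn
    exact ⟨q y, hq0 y, fun w hw => hy hw⟩
  set u : ℝ → EuclideanSpace ℝ (Fin d) → ℝ := fun s y => gaussMean s F y / gaussMean s q y
  have hu : ∀ s y, |u s y| ≤ Mf := fun s y =>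
    abs_gaussMean_mul_div_le hq.continuous (fun y => (hq0 y).le) hMq hMf s y
  have hum : ∀ s, Measurable (u s) := fun s =>
    (continuous_gaussMean hF.continuous hMF s).measurable.div
      (continuous_gaussMean hq.continuous hMq s).measurable
  have hlim : Tendsto (fun s : ℝ => ∫ z, gaussWeight z *
      ((s ^ 2)⁻¹ * (u s (x + s • z) - f (x + s • z)))) (𝓝[>] 0)
      (𝓝 (∫ z : EuclideanSpace ℝ (Fin d), gaussWeight z *
        ((laplacian F x / 4 - f x * (laplacian q x / 4)) / q x))) := by
    set D : ℝ := (KF + LF + Mf * (Kq + Lq)) / (m / 2)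
    have hD0 : 0 ≤ D := by positivity
    refine tendsto_integral_filter_of_dominated_convergence
      (fun z => D * (gaussWeight z * ‖z‖ ^ 0) + 2 * Mf * (gaussWeight z * ‖z‖ ^ 2))
      (.of_forall fun s => ?_) ?_
      (((integrable_gaussWeight_mul_norm_pow (by norm_num)).const_mul _).add
        ((integrable_gaussWeight_mul_norm_pow (by norm_num)).const_mul _))
      (.of_forall fun z => ?_)
    · have hv : Measurable fun z : EuclideanSpace ℝ (Fin d) => x + s • z := by fun_prop
      exact (continuous_gaussWeight.measurable.mul ((((hum s).comp hv).sub
        (hf.continuous.measurable.comp hv)).const_mul _)).aestronglyMeasurable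
    · have hsmall : ∀ᶠ s : ℝ in 𝓝[>] 0, s ^ 2 * (Kq + Lq) < m / 2 := by
        have hc : Continuous fun s : ℝ => s ^ 2 * (Kq + Lq) := by fun_prop
        have ht := (hc.tendsto 0).mono_left (nhdsWithin_le_nhds (s := Set.Ioi (0 : ℝ)))
        refine ht.eventually_lt_const ?_
        simpa using hm0
      have hone : ∀ᶠ s : ℝ in 𝓝[>] 0, s ≤ 1 :=
        nhdsWithin_le_nhds (eventually_le_nhds one_pos)
      filter_upwards [self_mem_nhdsWithin, hsmall, hone] with s (hs : 0 < s) hsm hs1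
      refine .of_forall fun z => ?_
      rw [norm_mul, Real.norm_of_nonneg (gaussWeight_pos z).le]
      suffices h : ‖(s ^ 2)⁻¹ * (u s (x + s • z) - f (x + s • z))‖ ≤ D + 2 * Mf * ‖z‖ ^ 2 by
        calc _ ≤ gaussWeight z * (D + 2 * Mf * ‖z‖ ^ 2) :=
              mul_le_mul_of_nonneg_left h (gaussWeight_pos z).le
          _ = _ := by ring
      set y := x + s • z with hy
      rcases le_or_gt ‖s • z‖ 1 with hz | hz
      · have hqy : m ≤ q y := hm y (by simpa [hy] using hz)
        have hgq := abs_gaussMean_sub_le hKq0 hKq hLq hs.le hs1 y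
        have hgF := abs_gaussMean_sub_le hKF0 hKF hLF hs.le hs1 y
        have hden : m / 2 ≤ gaussMean s q y := by linarith [(abs_le.1 hgq).1]
        have hden0 : 0 < gaussMean s q y := by linarith
        have hscale : ∀ {a b : ℝ}, |a| ≤ s ^ 2 * b → |(s ^ 2)⁻¹ * a| ≤ b := fun {a b} hab => by
          rw [abs_mul, abs_of_nonneg (by positivity), inv_mul_le_iff₀ (by positivity)]
          exact hab
        refine le_trans ?_ (le_add_of_nonneg_right (by positivity))
        rw [gaussMean_diffQuotient_div_eq hden0.ne', norm_div, Real.norm_of_nonneg hden0.le]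
        refine div_le_div₀ (by positivity) ?_ (by positivity) hden
        refine (abs_sub _ _).trans (add_le_add (hscale hgF) ?_)
        rw [abs_mul]
        exact mul_le_mul (hMf y) (hscale hgq) (abs_nonneg _) hMf0
      · refine le_trans ?_ (le_add_of_nonneg_left hD0)
        rw [norm_mul, Real.norm_of_nonneg (by positivity)]
        have h1 : ‖u s y - f y‖ ≤ 2 * Mf := by
          refine (norm_sub_le _ _).trans ?_
          have := add_le_add (hu s y) (hMf y)
          simpa only [Real.norm_eq_abs, two_mul] using this
        have h2 : (s ^ 2)⁻¹ ≤ ‖z‖ ^ 2 := by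
          rw [norm_smul, Real.norm_of_nonneg hs.le] at hz
          rw [inv_le_iff_one_le_mul₀' (by positivity), ← mul_pow]
          exact one_le_pow₀ hz.le
        calc _ ≤ ‖z‖ ^ 2 * (2 * Mf) := by gcongr
          _ = _ := by ring
    · refine Tendsto.const_mul _ ?_
      have hline : Tendsto (fun s : ℝ => x + s • z) (𝓝[>] 0) (𝓝 x) := by
        have hc : Continuous fun s : ℝ => x + s • z := by fun_prop
        simpa using (hc.tendsto 0).mono_left nhdsWithin_le_nhds
      have hFl := tendsto_gaussMean_diffQuotient (hF.of_le (by norm_num)) hKF x z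
      have hql := tendsto_gaussMean_diffQuotient (hq.of_le (by norm_num)) hKq x z
      have hqx := (hq.continuous.tendsto x).comp hline
      have hfx := (hf.continuous.tendsto x).comp hline
      have hsq : Tendsto (fun s : ℝ => s ^ 2) (𝓝[>] 0) (𝓝 0) := by
        have hc : Continuous fun s : ℝ => s ^ 2 := by fun_prop
        simpa using (hc.tendsto 0).mono_left nhdsWithin_le_nhds
      have hden : Tendsto (fun s : ℝ => gaussMean s q (x + s • z)) (𝓝[>] 0) (𝓝 (q x)) := by
        have h := hqx.add (hsq.mul hql)
        rw [zero_mul, add_zero] at h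
        refine h.congr' ?_
        filter_upwards [self_mem_nhdsWithin] with s (hs : 0 < s)
        simp only [Function.comp_apply]
        field_simp
        ring
      refine ((hFl.sub (hfx.mul hql)).div hden (hq0 x).ne').congr' ?_
      filter_upwards [hden.eventually_ne (hq0 x).ne'] with s hs
      exact (gaussMean_diffQuotient_div_eq hs).symm
  rw [integral_mul_const, integral_gaussWeight, one_mul] at hlim
  have hfl := tendsto_gaussMean_diffQuotient (hf.of_le (by norm_num)) hKf x 0
  simp only [smul_zero, add_zero] at hfl
  refine (hlim.add hfl).congr fun s => ?_
  have iu := gaussMean_integrable (hum s) (hu s) s x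
  have i_f := gaussMean_integrable hf.continuous.measurable hMf s x
  have hsplit : ∀ z, gaussWeight z * ((s ^ 2)⁻¹ * (u s (x + s • z) - f (x + s • z))) =
      (s ^ 2)⁻¹ * (gaussWeight z * u s (x + s • z) - gaussWeight z * f (x + s • z)) :=
    fun z => by ring
  simp only [hsplit]
  rw [integral_const_mul, integral_sub iu i_f]
  change (s ^ 2)⁻¹ * (gaussMean s (u s) x - gaussMean s f x) + _ =
    (s ^ 2)⁻¹ * (gaussMean s (u s) x - f x)
  ring

lemma laplacian_mul {q f : EuclideanSpace ℝ (Fin d) → ℝ} (hq : ContDiff ℝ 2 q)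
    (hf : ContDiff ℝ 2 f) (x : EuclideanSpace ℝ (Fin d)) :
    laplacian (fun y => q y * f y) x =
      q x * laplacian f x + f x * laplacian q x + 2 * ⟪gradient q x, gradient f x⟫ := by
  have hq1 : Differentiable ℝ q := hq.differentiable (by norm_num)
  have hf1 : Differentiable ℝ f := hf.differentiable (by norm_num)
  have hq2 : Differentiable ℝ (fderiv ℝ q) :=
    (hq.fderiv_right (m := 1) (by norm_num)).differentiable (by norm_num)
  have hf2 : Differentiable ℝ (fderiv ℝ f) :=
    (hf.fderiv_right (m := 1) (by norm_num)).differentiable (by norm_num)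
  have h1 : fderiv ℝ (fun y => q y * f y) = fun y => q y • fderiv ℝ f y + f y • fderiv ℝ q y :=
    funext fun y => fderiv_fun_mul (hq1 y) (hf1 y)
  have h2 : fderiv ℝ (fun y => q y • fderiv ℝ f y + f y • fderiv ℝ q y) x = _ :=
    (((hq1 x).hasFDerivAt.smul (hf2 x).hasFDerivAt).add
      ((hf1 x).hasFDerivAt.smul (hq2 x).hasFDerivAt)).fderiv
  rw [inner_gradient_eq_sum]
  simp only [laplacian_eq_sum_fderiv, h1, h2, Finset.mul_sum, ← Finset.sum_add_distrib]
  refine Finset.sum_congr rfl fun i _ => ?_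
  simp
  ring

end Generator

/-- Pointwise generator of the forward–backward diffusion operator is the `q`-weighted
Laplacian: `ε⁻¹ (D_ε(𝒟_ε f)(x) − f(x)) → (1/2) q⁻¹ ∇·(q ∇f)(x)
= (1/2) Δf(x) + (1/(2q(x))) ∇q(x)·∇f(x)` as `ε → 0⁺`. -/
theorem forward_backward_generator_weighted_laplacian
    {d : ℕ} (q : EuclideanSpace ℝ (Fin d) → ℝ)
    (hqsmooth : ContDiff ℝ (⊤ : ℕ∞) q) (hqpos : ∀ x, 0 < q x) (hqint : ∫ x, q x = 1)
    (hqderivbdd : ∀ n : ℕ, ∃ C : ℝ, ∀ x, ‖iteratedFDeriv ℝ n q x‖ ≤ C)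
    (hqlower : ∃ C c : ℝ, 0 < C ∧ 0 < c ∧
      ∀ y, C * Real.exp (-c * ‖y‖ ^ 2) ≤ q y)
    (f : EuclideanSpace ℝ (Fin d) → ℝ)
    (hf : ContDiff ℝ (⊤ : ℕ∞) f) (hfsupp : HasCompactSupport f)
    (kε : ℝ → EuclideanSpace ℝ (Fin d) → EuclideanSpace ℝ (Fin d) → ℝ)
    (hkε : ∀ ε x y, kε ε x y = Real.pi ^ (-(d : ℝ) / 2) * Real.exp (-‖x - y‖ ^ 2 / ε))
    (Dε : ℝ → (EuclideanSpace ℝ (Fin d) → ℝ) → EuclideanSpace ℝ (Fin d) → ℝ)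
    (hDε : ∀ ε g x, Dε ε g x = ε ^ (-(d : ℝ) / 2) * ∫ y, kε ε x y * g y)
    (𝒟ε : ℝ → (EuclideanSpace ℝ (Fin d) → ℝ) → EuclideanSpace ℝ (Fin d) → ℝ)
    (h𝒟ε : ∀ ε g x, 𝒟ε ε g x = Dε ε (fun y => q y * g y) x / Dε ε q x)
    (x : EuclideanSpace ℝ (Fin d)) :
    Tendsto (fun ε : ℝ => ε⁻¹ * (Dε ε (𝒟ε ε f) x - f x)) (𝓝[>] (0 : ℝ))
      (𝓝 ((1 / 2) * (q x)⁻¹ * divergence (fun y => q y • gradient f y) x)) ∧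
    (1 / 2) * (q x)⁻¹ * divergence (fun y => q y • gradient f y) x
      = (1 / 2) * laplacian f x + (1 / (2 * q x)) * ⟪gradient q x, gradient f x⟫ := by
  have hq3 : ContDiff ℝ 3 q := contDiff_infty.1 hqsmooth 3
  have hf3 : ContDiff ℝ 3 f := contDiff_infty.1 hf 3
  have hq2 : ContDiff ℝ 2 q := hq3.of_le (by norm_num)
  have hf2 : ContDiff ℝ 2 f := hf3.of_le (by norm_num)
  have hqx := (hqpos x).ne'
  have hdiv := divergence_smul_gradient (hq2.of_le (by norm_num)) hf2 x
  refine ⟨?_, by rw [hdiv]; field_simp⟩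
  have hsqrt : Tendsto Real.sqrt (𝓝[>] 0) (𝓝[>] 0) := by
    refine tendsto_nhdsWithin_iff.2 ⟨?_, ?_⟩
    · simpa using (Real.continuous_sqrt.tendsto 0).mono_left nhdsWithin_le_nhds
    · filter_upwards [self_mem_nhdsWithin] with ε hε using Real.sqrt_pos.2 hε
  have hlim := (tendsto_gaussMean_normalized_diffQuotient hq3 hqpos hqderivbdd hf3 hfsupp x).comp
    hsqrt
  have hval : (laplacian (fun y => q y * f y) x / 4 - f x * (laplacian q x / 4)) / q x
      + laplacian f x / 4 = (1 / 2) * (q x)⁻¹ * divergence (fun y => q y • gradient f y) x := by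
    rw [hdiv, laplacian_mul hq2 hf2]
    field_simp
    ring
  rw [hval] at hlim
  refine hlim.congr' ?_
  filter_upwards [self_mem_nhdsWithin] with ε (hε : 0 < ε)
  have hD : ∀ g y, Dε ε g y = gaussMean (√ε) g y := fun g y => by
    rw [hDε, ← rpow_mul_integral_eq_gaussMean (Real.sqrt_pos.2 hε), Real.sq_sqrt hε.le]
    simp only [hkε]
  have hDD : 𝒟ε ε f = fun y =>
      gaussMean (√ε) (fun y => q y * f y) y / gaussMean (√ε) q y := by
    funext y
    rw [h𝒟ε, hD, hD]
  rw [hD, hDD, Function.comp_apply, Real.sq_sqrt hε.le]
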